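/- Let U be a finite linearly ordered set, let ε ≥ 0, and let f be a random function from U to ℕ on a probability space such that for every nonempty A ⊆ U and every y ∈ A, Pr[y = m_f(A)] ∈ [(1 − ε)/|A|, (1 + ε)/|A|], where m_f(A) is the least element of A attaining the minimum of f on A. Then for all nonempty S, T ⊆ U, Pr[m_f(S) = m_f(T)] ∈ [(1 − ε)·J, (1 + ε)·J], where J = |S ∩ T| / |S ∪ T| is the Jaccard similarity of S and T. -/

import Mathlib

open MeasureTheory

/-- The min-hash of a nonempty finite set `A` under `f`: the least element of `A`
attaining the minimum of `f` on `A`. -/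
noncomputable def minHash {U : Type*} [LinearOrder U] (f : U → ℕ) (A : Finset U)
    (h : A.Nonempty) : U :=
  (A.filter fun y => f y = A.inf' h f).min' (by
    obtain ⟨y, hy, hfy⟩ := Finset.exists_mem_eq_inf' h f
    exact ⟨y, Finset.mem_filter.2 ⟨hy, hfy.symm⟩⟩)

theorem minHash_eq_iff {U : Type*} [LinearOrder U] (f : U → ℕ) (A : Finset U)
    (h : A.Nonempty) (y : U) :
    minHash f A h = y ↔ y ∈ A ∧ ∀ x ∈ A, f y < f x ∨ f y = f x ∧ y ≤ x := by
  have hmem : minHash f A h ∈ A.filter fun y => f y = A.inf' h f := Finset.min'_mem _ _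
  rw [Finset.mem_filter] at hmem
  have hle : ∀ x ∈ A, f (minHash f A h) < f x ∨
      f (minHash f A h) = f x ∧ minHash f A h ≤ x := by
    intro x hx
    have hfx : f (minHash f A h) ≤ f x := hmem.2 ▸ Finset.inf'_le f hx
    rcases hfx.lt_or_eq with hlt | heq
    · exact Or.inl hlt
    · exact Or.inr ⟨heq, Finset.min'_le _ _ (Finset.mem_filter.2 ⟨hx, heq ▸ hmem.2⟩)⟩
  constructor
  · rintro rfl
    exact ⟨hmem.1, hle⟩
  · rintro ⟨hy, hmin⟩
    have h₁ := hle y hy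
    have h₂ := hmin _ hmem.1
    exact le_antisymm (by grind) (by grind)

theorem minHash_eq_minHash_iff {U : Type*} [LinearOrder U] (f : U → ℕ) (S T : Finset U)
    (hS : S.Nonempty) (hT : T.Nonempty) (hST : (S ∪ T).Nonempty) :
    minHash f S hS = minHash f T hT ↔ minHash f (S ∪ T) hST ∈ S ∩ T := by
  constructor
  · intro h
    obtain ⟨hyS, hS'⟩ := (minHash_eq_iff f S hS _).1 h
    obtain ⟨hyT, hT'⟩ := (minHash_eq_iff f T hT _).1 rfl
    rw [(minHash_eq_iff f (S ∪ T) hST (minHash f T hT)).2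
      ⟨Finset.mem_union_left _ hyS, fun x hx => (Finset.mem_union.1 hx).elim (hS' x) (hT' x)⟩]
    exact Finset.mem_inter.2 ⟨hyS, hyT⟩
  · intro h
    obtain ⟨hyS, hyT⟩ := Finset.mem_inter.1 h
    have hmin := ((minHash_eq_iff f (S ∪ T) hST _).1 rfl).2
    rw [(minHash_eq_iff f S hS _).2 ⟨hyS, fun x hx => hmin x (Finset.mem_union_left _ hx)⟩,
      (minHash_eq_iff f T hT _).2 ⟨hyT, fun x hx => hmin x (Finset.mem_union_right _ hx)⟩]

theorem measurableSet_minHash_eq {U : Type*} [LinearOrder U] {Ω : Type*} [MeasurableSpace Ω]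
    {f : Ω → U → ℕ} (hf : ∀ x : U, Measurable fun ω => f ω x) (A : Finset U)
    (hA : A.Nonempty) (y : U) : MeasurableSet {ω | minHash (f ω) A hA = y} := by
  have hset : {ω | minHash (f ω) A hA = y} = {_ω | y ∈ A} ∩
      ⋂ x ∈ A, ({ω | f ω y < f ω x} ∪ ({ω | f ω y = f ω x} ∩ {_ω | y ≤ x})) := by
    ext ω
    simp [minHash_eq_iff]
  rw [hset]
  exact (MeasurableSet.const _).inter <| A.measurableSet_biInter fun x _ =>
    (measurableSet_lt (hf y) (hf x)).union
      ((measurableSet_eq_fun (hf y) (hf x)).inter (MeasurableSet.const _))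

/-- If a random function `f` is `ε`-minwise independent on a finite linearly ordered
set `U`, then for all nonempty `S, T ⊆ U` the collision probability of min-wise
hashing is within a `(1 ± ε)` factor of the Jaccard similarity `J = |S∩T|/|S∪T|`. -/
theorem stmt15 {U : Type*} [Fintype U] [LinearOrder U] {Ω : Type*} [MeasurableSpace Ω]
    (μ : Measure Ω) [IsProbabilityMeasure μ] (ε : ℝ) (hε : 0 ≤ ε)
    (f : Ω → U → ℕ) (hfmeas : ∀ x : U, Measurable fun ω => f ω x)
    (hminwise : ∀ (A : Finset U) (hA : A.Nonempty) (y : U), y ∈ A →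
      (μ {ω | minHash (f ω) A hA = y}).toReal ∈
        Set.Icc ((1 - ε) / (A.card : ℝ)) ((1 + ε) / (A.card : ℝ)))
    (S T : Finset U) (hS : S.Nonempty) (hT : T.Nonempty) :
    (μ {ω | minHash (f ω) S hS = minHash (f ω) T hT}).toReal ∈
      Set.Icc ((1 - ε) * (((S ∩ T).card : ℝ) / ((S ∪ T).card : ℝ)))
        ((1 + ε) * (((S ∩ T).card : ℝ) / ((S ∪ T).card : ℝ))) := by
  have hST : (S ∪ T).Nonempty := hS.mono Finset.subset_union_left
  have hevent : {ω | minHash (f ω) S hS = minHash (f ω) T hT} =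
      ⋃ y ∈ S ∩ T, {ω | minHash (f ω) (S ∪ T) hST = y} := by
    ext ω
    simp only [Set.mem_ofPred_eq, minHash_eq_minHash_iff (f ω) S T hS hT hST, Set.mem_iUnion,
      exists_prop, exists_eq_right']
  have hsum : (μ {ω | minHash (f ω) S hS = minHash (f ω) T hT}).toReal =
      ∑ y ∈ S ∩ T, (μ {ω | minHash (f ω) (S ∪ T) hST = y}).toReal := by
    rw [hevent]
    refine measureReal_biUnion_finset (μ := μ) ?_
      fun y _ => measurableSet_minHash_eq hfmeas (S ∪ T) hST y
    intro a _ b _ hab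
    exact Set.disjoint_left.2 fun ω ha hb => hab (ha.symm.trans hb)
  have hbound := fun y (hy : y ∈ S ∩ T) => hminwise (S ∪ T) hST y
    (Finset.mem_union_left _ (Finset.mem_inter.1 hy).1)
  rw [hsum, Set.mem_Icc]
  constructor
  · calc (1 - ε) * (((S ∩ T).card : ℝ) / ((S ∪ T).card : ℝ))
        = (S ∩ T).card • ((1 - ε) / ((S ∪ T).card : ℝ)) := by rw [nsmul_eq_mul]; ring
      _ ≤ _ := Finset.card_nsmul_le_sum _ _ _ fun y hy => (hbound y hy).1
  · calc _ ≤ (S ∩ T).card • ((1 + ε) / ((S ∪ T).card : ℝ)) :=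
          Finset.sum_le_card_nsmul _ _ _ fun y hy => (hbound y hy).2
      _ = (1 + ε) * (((S ∩ T).card : ℝ) / ((S ∪ T).card : ℝ)) := by rw [nsmul_eq_mul]; ring
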